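/- Residue of the Izergin determinant at x_n = y_n: let x̄ = (x₁,…,x_{n−1}), ȳ = (y₁,…,y_{n−1}) be admissible tuples and let y_n ∈ ℂ be distinct from all x_i, all y_j, and such that y_n is distinct from the x_i (i.e. the tuples (x̄, t) and (ȳ, y_n) are admissible for all t near y_n with t ≠ y_n, t ∉ {x_i}, t ∉ {y_j}). Then the limit lim_{t → y_n} (t − y_n)·K_n((x̄, t)|(ȳ, y_n)) exists and equals (q − q⁻¹)·f(y_n, ȳ)·f(x̄, y_n)·K_{n−1}(x̄|ȳ), where f(y_n,ȳ) = ∏_{j=1}^{n−1} f(y_n, y_j) and f(x̄,y_n) = ∏_{i=1}^{n−1} f(x_i, y_n). -/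

import Mathlib

open Finset

/-- The function `f(u,v) = (qu - q⁻¹v)/(u - v)`. -/
noncomputable def fF (q u v : ℂ) : ℂ := (q * u - q⁻¹ * v) / (u - v)

/-- The function `g(u,v) = (q - q⁻¹)/(u - v)`. -/
noncomputable def gF (q u v : ℂ) : ℂ := (q - q⁻¹) / (u - v)

/-- The Izergin determinant `K_n(x̄|ȳ)`. -/
noncomputable def Kiz (q : ℂ) {n : ℕ} (x y : Fin n → ℂ) : ℂ :=
  (∏ i : Fin n, ∏ j ∈ Finset.Ioi i, ((x i - x j) * (y j - y i)))⁻¹ *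
    ∑ σ : Equiv.Perm (Fin n), ((Equiv.Perm.sign σ : ℤ) : ℂ) *
      ∏ i : Fin n,
        ((q - q⁻¹) / (x i - y (σ i)) *
          ∏ j ∈ Finset.univ.erase (σ i), (q * x i - q⁻¹ * y j))

/-- The modified Izergin determinant `K^{(l)}_n(x̄|ȳ) = (∏ x_i)·K_n(x̄|ȳ)`. -/
noncomputable def Kl (q : ℂ) {n : ℕ} (x y : Fin n → ℂ) : ℂ := (∏ i, x i) * Kiz q x y

/-- The modified Izergin determinant `K^{(r)}_n(x̄|ȳ) = (∏ y_j)·K_n(x̄|ȳ)`. -/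
noncomputable def Kr (q : ℂ) {n : ℕ} (x y : Fin n → ℂ) : ℂ := (∏ j, y j) * Kiz q x y

/-- The matrix whose determinant is the numerator of the Izergin determinant. -/
noncomputable def izerginMatrix (q : ℂ) {n : ℕ} (x y : Fin n → ℂ) : Matrix (Fin n) (Fin n) ℂ :=
  fun i j => (q - q⁻¹) / (x i - y j) * ∏ k ∈ Finset.univ.erase j, (q * x i - q⁻¹ * y k)

theorem Kiz_eq_det (q : ℂ) {n : ℕ} (x y : Fin n → ℂ) :
    Kiz q x y = (∏ i : Fin n, ∏ j ∈ Finset.Ioi i, ((x i - x j) * (y j - y i)))⁻¹ *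
      (izerginMatrix q x y).det := by
  rw [Kiz, ← Matrix.det_transpose, Matrix.det_apply']
  rfl

theorem prod_prod_Ioi_castSucc {M : Type*} [CommMonoid M] {n : ℕ}
    (F : Fin (n + 1) → Fin (n + 1) → M) :
    ∏ i, ∏ j ∈ Finset.Ioi i, F i j =
      (∏ i : Fin n, ∏ j ∈ Finset.Ioi i, F i.castSucc j.castSucc) *
        ∏ i : Fin n, F i.castSucc (Fin.last n) := by
  have h (m : ℕ) (G : Fin m → M) (i : Fin m) :
      ∏ j ∈ Finset.Ioi i, G j = ∏ j, if i < j then G j else 1 := by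
    rw [← Finset.prod_filter]
    congr 1
    ext j
    simp
  simp only [h, Fin.prod_univ_castSucc, Fin.castSucc_lt_castSucc_iff, Fin.castSucc_lt_last,
    if_true, Finset.prod_mul_distrib]
  simp [Fin.le_last, not_lt_of_ge]

theorem prod_erase_castSucc {M : Type*} [CommMonoid M] {n : ℕ} (F : Fin (n + 1) → M)
    (j : Fin n) :
    ∏ k ∈ Finset.univ.erase j.castSucc, F k =
      (∏ k ∈ Finset.univ.erase j, F k.castSucc) * F (Fin.last n) := by
  have h (m : ℕ) (G : Fin m → M) (i : Fin m) :
      ∏ k ∈ Finset.univ.erase i, G k = ∏ k, if k ≠ i then G k else 1 := by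
    rw [← Finset.prod_filter, Finset.filter_ne']
  rw [h, h, Fin.prod_univ_castSucc]
  simp [(Fin.castSucc_lt_last j).ne']

theorem prod_erase_last {M : Type*} [CommMonoid M] {n : ℕ} (F : Fin (n + 1) → M) :
    ∏ k ∈ Finset.univ.erase (Fin.last n), F k = ∏ k : Fin n, F k.castSucc := by
  rw [← Finset.filter_ne', Finset.prod_filter, Fin.prod_univ_castSucc]
  simp [fun k : Fin n => (Fin.castSucc_lt_last k).ne]

/-- The Izergin matrix of `(x̄, t)`, `(ȳ, yₙ)` with its last row multiplied by `t - yₙ`, the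
removable singularity at `t = yₙ` being filled in. -/
noncomputable def izerginMatrixScaled (q : ℂ) {n : ℕ} (x y : Fin n → ℂ) (yn t : ℂ) :
    Matrix (Fin (n + 1)) (Fin (n + 1)) ℂ :=
  (izerginMatrix q (Fin.snoc x t : Fin (n + 1) → ℂ) (Fin.snoc y yn)).updateRow (Fin.last n)
    (Fin.snoc
      (fun j => (t - yn) * ((q - q⁻¹) / (t - y j) *
        ((∏ k ∈ Finset.univ.erase j, (q * t - q⁻¹ * y k)) * (q * t - q⁻¹ * yn))))
      ((q - q⁻¹) * ∏ k, (q * t - q⁻¹ * y k)))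

theorem det_izerginMatrixScaled (q : ℂ) {n : ℕ} (x y : Fin n → ℂ) {yn t : ℂ} (ht : t ≠ yn) :
    (izerginMatrixScaled q x y yn t).det =
      (t - yn) * (izerginMatrix q (Fin.snoc x t : Fin (n + 1) → ℂ) (Fin.snoc y yn)).det := by
  have h := Matrix.det_updateRow_smul
    (izerginMatrix q (Fin.snoc x t : Fin (n + 1) → ℂ) (Fin.snoc y yn)) (Fin.last n) (t - yn)
    (izerginMatrix q (Fin.snoc x t : Fin (n + 1) → ℂ) (Fin.snoc y yn) (Fin.last n))
  rw [Matrix.updateRow_eq_self] at h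
  rw [← h, izerginMatrixScaled]
  congr 2
  ext j
  refine Fin.lastCases ?_ (fun j => ?_) j
  · have := sub_ne_zero.mpr ht
    simp only [izerginMatrix, prod_erase_last, Pi.smul_apply, smul_eq_mul, Fin.snoc_last,
      Fin.snoc_castSucc]
    field_simp
  · simp [izerginMatrix, prod_erase_castSucc]

theorem det_izerginMatrixScaled_self (q : ℂ) {n : ℕ} (x y : Fin n → ℂ) (yn : ℂ) :
    (izerginMatrixScaled q x y yn yn).det =
      ((q - q⁻¹) * ∏ k, (q * yn - q⁻¹ * y k)) *
        ((∏ i, (q * x i - q⁻¹ * yn)) * (izerginMatrix q x y).det) := by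
  rw [Matrix.det_succ_row _ (Fin.last n), Fin.sum_univ_castSucc, ← Matrix.det_mul_column]
  have hsub : (izerginMatrixScaled q x y yn yn).submatrix (Fin.last n).succAbove
      (Fin.last n).succAbove =
      Matrix.of fun i j => (q * x i - q⁻¹ * yn) * izerginMatrix q x y i j := by
    ext i j
    simp [izerginMatrixScaled, izerginMatrix, Matrix.updateRow_apply, prod_erase_castSucc,
      (Fin.castSucc_lt_last i).ne]
    ring
  rw [hsub]
  simp [izerginMatrixScaled, Even.neg_one_pow (Even.add_self n)]

theorem continuousAt_izerginMatrixScaled (q : ℂ) {n : ℕ} (x y : Fin n → ℂ) {yn : ℂ}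
    (hyny : ∀ j, yn ≠ y j) : ContinuousAt (izerginMatrixScaled q x y yn) yn := by
  refine continuousAt_pi.mpr fun i => continuousAt_pi.mpr fun j => ?_
  refine Fin.lastCases ?_ (fun i => ?_) i
  · refine Fin.lastCases ?_ (fun j => ?_) j
    · simp only [izerginMatrixScaled, Matrix.updateRow_self, Fin.snoc_last]
      fun_prop
    · have := sub_ne_zero.mpr (hyny j)
      simp only [izerginMatrixScaled, Matrix.updateRow_self, Fin.snoc_castSucc]
      fun_prop (disch := assumption)
  · simp only [izerginMatrixScaled, izerginMatrix, Matrix.updateRow_apply, Fin.snoc_castSucc,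
      (Fin.castSucc_lt_last i).ne, if_false]
    exact continuousAt_const

/-- Residue of the Izergin determinant at `x_n = y_n`:
`lim_{t → y_n} (t − y_n)·K_n((x̄, t)|(ȳ, y_n))
  = (q − q⁻¹)·f(y_n, ȳ)·f(x̄, y_n)·K_{n−1}(x̄|ȳ)`. -/
theorem izergin_residue (q : ℂ) (hq : q ≠ 0) (hq2 : q ^ 2 ≠ 1)
    (n : ℕ) (x y : Fin n → ℂ)
    (hx : Function.Injective x) (hy : Function.Injective y)
    (hxy : ∀ i j, x i ≠ y j)
    (yn : ℂ) (hynx : ∀ i, yn ≠ x i) (hyny : ∀ j, yn ≠ y j) :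
    Filter.Tendsto
      (fun t => (t - yn) * Kiz q (Fin.snoc x t : Fin (n + 1) → ℂ) (Fin.snoc y yn))
      (nhdsWithin yn {t : ℂ | t ≠ yn ∧ (∀ i, t ≠ x i) ∧ ∀ j, t ≠ y j})
      (nhds ((q - q⁻¹) * (∏ j, fF q yn (y j)) * (∏ i, fF q (x i) yn) * Kiz q x y)) := by
  have hdet : ContinuousAt (fun t => (izerginMatrixScaled q x y yn t).det) yn :=
    (continuous_id.matrix_det).continuousAt.comp (continuousAt_izerginMatrixScaled q x y hyny)
  have hpre : ContinuousAt (fun t => (((∏ i : Fin n, ∏ j ∈ Finset.Ioi i,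
      ((x i - x j) * (y j - y i))) * ∏ i, ((x i - t) * (yn - y i)))⁻¹)) yn := by
    refine ContinuousAt.inv₀ (by fun_prop) (mul_ne_zero ?_ ?_)
    · refine Finset.prod_ne_zero_iff.mpr fun i _ => Finset.prod_ne_zero_iff.mpr fun j hj => ?_
      have hij : i ≠ j := (Finset.mem_Ioi.mp hj).ne
      exact mul_ne_zero (sub_ne_zero.mpr (hx.ne hij)) (sub_ne_zero.mpr (hy.ne hij.symm))
    · exact Finset.prod_ne_zero_iff.mpr fun i _ =>
        mul_ne_zero (sub_ne_zero.mpr (hynx i).symm) (sub_ne_zero.mpr (hyny i))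
  have hlim := (hpre.mul hdet).tendsto.mono_left
    (nhdsWithin_le_nhds (s := {t : ℂ | t ≠ yn ∧ (∀ i, t ≠ x i) ∧ ∀ j, t ≠ y j}))
  simp only [Pi.mul_apply, det_izerginMatrixScaled_self] at hlim
  convert hlim.congr' ?_ using 2
  · rw [Kiz_eq_det]
    simp only [fF, Finset.prod_div_distrib, Finset.prod_mul_distrib]
    ring
  · filter_upwards [self_mem_nhdsWithin] with t ht
    rw [Pi.mul_apply, det_izerginMatrixScaled q x y ht.1, Kiz_eq_det, prod_prod_Ioi_castSucc]
    simp only [Fin.snoc_last, Fin.snoc_castSucc]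
    ring
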